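/- Under assumption (A), for every driving force f (constant, or continuous and 1-periodic) and every mean spacing ρ ∈ ℝ (rational or irrational), there exists a synchronized solution u(t) of the FK gradient dynamics, defined for all t ∈ ℝ, all of whose configurations u(t) have bounded width with mean spacing ρ. -/

import Mathlib

open MeasureTheory Filter Topology
open scoped ENNReal

noncomputable section

/-- Configurations of the FK chain. -/
abbrev Conf : Type := ℤ → ℝ

/-- Vertical translation of a configuration by an integer `n`. -/
def vshift (n : ℤ) (u : Conf) : Conf := fun j => u j + (n : ℝ)

/-- Spatial translation `S_{m,n} u_j = u_{j-m} + n`. -/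
def Smn (m n : ℤ) (u : Conf) : Conf := fun j => u (j - m) + (n : ℝ)

/-- Horizontal shift by `n` sites. -/
def shiftn (n : ℤ) (u : Conf) : Conf := fun j => u (j - n)

/-- `u` has bounded width with mean spacing `ρ`. -/
def BW (ρ : ℝ) (u : Conf) : Prop :=
  ∃ K > (0 : ℝ), ∀ m n : ℤ, |u m - u n - ((m - n : ℤ) : ℝ) * ρ| ≤ K

/-- Distinct configurations `u`, `v` intersect at site `j`. -/
def IntersectAt (u v : Conf) (j : ℤ) : Prop :=
  u ≠ v ∧ (v (j + 1) - u (j + 1)) * (v j - u j) ≤ 0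

/-- `u` and `v` intersect (at some site). -/
def Intersects (u v : Conf) : Prop := ∃ j, IntersectAt u v j

/-- The intersection of `u` and `v` at site `j` is transversal. -/
def TransAt (u v : Conf) (j : ℤ) : Prop :=
  (v (j + 1) - u (j + 1)) * (v j - u j) < 0 ∨
    (u j = v j ∧ (v (j - 1) - u (j - 1)) * (v (j + 1) - u (j + 1)) < 0)

/-- `u` and `v` intersect non-transversally at site `j`. -/
def NonTransAt (u v : Conf) (j : ℤ) : Prop := IntersectAt u v j ∧ ¬ TransAt u v j

/-- `u` and `v` have a non-transversal intersection. -/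
def HasNonTransInter (u v : Conf) : Prop := ∃ j, NonTransAt u v j

/-- `u` and `v` intersect more than once: there are sites `j < k` at which they
intersect, with `u i ≠ v i` for some `j < i ≤ k`. -/
def IntersectsTwice (u v : Conf) : Prop :=
  ∃ j k : ℤ, j < k ∧ IntersectAt u v j ∧ IntersectAt u v k ∧
    ∃ i : ℤ, j < i ∧ i ≤ k ∧ u i ≠ v i

/-- The generalized FK model, under the standing assumption (A):
`W` is `C²` and strictly convex with `W'' ≥ δ > 0`, `V` is `C¹` and 1-periodic,
and the driving `f` is either constant (DC) or continuous and 1-periodic (AC). -/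
structure FKModel where
  W : ℝ → ℝ
  V : ℝ → ℝ
  f : ℝ → ℝ
  W_smooth : ContDiff ℝ 2 W
  W_convex : ∃ δ > (0 : ℝ), ∀ x : ℝ, δ ≤ deriv (deriv W) x
  V_smooth : ContDiff ℝ 1 V
  V_periodic : ∀ x : ℝ, V (x + 1) = V x
  f_force : (∃ c : ℝ, ∀ t : ℝ, f t = c) ∨ (Continuous f ∧ ∀ t : ℝ, f (t + 1) = f t)

/-- The right-hand side of the FK gradient dynamics
`du_j/dt = W'(u_{j+1} − u_j) − W'(u_j − u_{j−1}) + V'(u_j) + f(t)`. -/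
def FKModel.rhs (M : FKModel) (t : ℝ) (u : Conf) (j : ℤ) : ℝ :=
  deriv M.W (u (j + 1) - u j) - deriv M.W (u j - u (j - 1)) + deriv M.V (u j) + M.f t

/-- A solution of the FK gradient dynamics defined for all `t ∈ ℝ`. -/
def IsSolution (M : FKModel) (u : ℝ → Conf) : Prop :=
  ∀ (t : ℝ) (j : ℤ), HasDerivAt (fun s => u s j) (M.rhs t (u t) j) t

/-- The identification `u ∼ u + n`, `n ∈ ℤ`. -/
instance confSetoid : Setoid Conf where
  r u v := ∃ n : ℤ, v = vshift n u
  iseqv := by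
    constructor
    · intro u
      exact ⟨0, by funext j; simp [vshift]⟩
    · rintro u v ⟨n, rfl⟩
      refine ⟨-n, ?_⟩
      funext j
      simp only [vshift]
      push_cast
      ring
    · rintro u v w ⟨n, rfl⟩ ⟨m, rfl⟩
      refine ⟨n + m, ?_⟩
      funext j
      simp only [vshift]
      push_cast
      ring

/-- The quotient space `X` of bounded-width configurations modulo `u ∼ u + n`. -/
abbrev X : Type := Quotient confSetoid

instance : MeasurableSpace X := borel X
instance : BorelSpace X := ⟨rfl⟩

/-- The set `X_ρ ⊆ X` of (classes of) configurations of bounded width with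
mean spacing `ρ`. -/
def Xrho (ρ : ℝ) : Set X := {x | BW ρ x.out}

/-- The shift `S_n` induced on `X`. -/
def Snq (n : ℤ) : X → X := fun x => ⟦shiftn n x.out⟧

/-- The shift `S = S_1` on `X`. -/
def Sq : X → X := Snq 1

/-- The time-`t` map induced on `X` by a semiflow `Φ` on configurations. -/
def Tq (Φ : ℝ → Conf → Conf) (t : ℝ) : X → X := fun x => ⟦Φ t x.out⟧

/-- `Φ` is the semiflow of the FK gradient dynamics for the model `M`:
trajectories solve the infinite ODE system, the semiflow commutes with the
spatial translations, leaves each `X̃_ρ` invariant, and descends continuously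
to the quotient `X`. -/
structure IsFKFlow (M : FKModel) (Φ : ℝ → Conf → Conf) : Prop where
  init : ∀ u : Conf, Φ 0 u = u
  semigroup : ∀ s t : ℝ, 0 ≤ s → 0 ≤ t → ∀ u : Conf, Φ (s + t) u = Φ s (Φ t u)
  isODE : ∀ (ρ : ℝ) (u : Conf), BW ρ u → ∀ (j : ℤ) (t : ℝ), 0 ≤ t →
    HasDerivWithinAt (fun s => Φ s u j) (M.rhs t (Φ t u) j) (Set.Ici (0 : ℝ)) t
  equivariant_vshift : ∀ t : ℝ, 0 ≤ t → ∀ (n : ℤ) (u : Conf),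
    Φ t (vshift n u) = vshift n (Φ t u)
  equivariant_shift : ∀ t : ℝ, 0 ≤ t → ∀ (n : ℤ) (u : Conf),
    Φ t (shiftn n u) = shiftn n (Φ t u)
  bw_invariant : ∀ (ρ : ℝ) (t : ℝ), 0 ≤ t → ∀ u : Conf, BW ρ u → BW ρ (Φ t u)
  continuous : ∀ t : ℝ, 0 ≤ t → Continuous (Tq Φ t)

/-- Invariance of a measure under a map, stated via preimages. -/
def MeasInv (g : X → X) (μ : Measure X) : Prop :=
  ∀ s : Set X, MeasurableSet s → μ (g ⁻¹' s) = μ s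

/-- The (topological) support of a measure. -/
def mSupport (μ : Measure X) : Set X :=
  {x | ∀ U : Set X, IsOpen U → x ∈ U → 0 < μ U}

/-- An `S,T`-invariant Borel probability measure on `X`. -/
def IsInvMeasure (Φ : ℝ → Conf → Conf) (μ : Measure X) : Prop :=
  IsProbabilityMeasure μ ∧ MeasInv Sq μ ∧ MeasInv (Tq Φ 1) μ

/-- Two points of `X` intersect: some representing configurations intersect. -/
def XIntersects (x y : X) : Prop :=
  ∃ u v : Conf, (⟦u⟧ : X) = x ∧ (⟦v⟧ : X) = y ∧ Intersects u v

/-- Two points of `X` have a non-transversal intersection. -/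
def XNonTrans (x y : X) : Prop :=
  ∃ u v : Conf, (⟦u⟧ : X) = x ∧ (⟦v⟧ : X) = y ∧ HasNonTransInter u v

/-- A synchronized measure: an `S,T`-invariant Borel probability measure no two
configurations of whose support intersect. -/
def IsSyncMeasure (Φ : ℝ → Conf → Conf) (μ : Measure X) : Prop :=
  IsInvMeasure Φ μ ∧ ∀ x ∈ mSupport μ, ∀ y ∈ mSupport μ, ¬ XIntersects x y

/-- `S_ρ`: the union of the supports of all synchronized measures with mean
spacing `ρ`. -/
def Srho (Φ : ℝ → Conf → Conf) (ρ : ℝ) : Set X :=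
  ⋃ μ ∈ {μ : Measure X | IsSyncMeasure Φ μ ∧ mSupport μ ⊆ Xrho ρ}, mSupport μ

/-- The union of the supports of all `S,T`-invariant Borel probability measures. -/
def unionSupports (Φ : ℝ → Conf → Conf) : Set X :=
  ⋃ μ ∈ {μ : Measure X | IsInvMeasure Φ μ}, mSupport μ

/-- The projection `π₀ : X → S¹ = ℝ/ℤ`, `u ↦ u₀ (mod 1)`. -/
def pi0 : X → AddCircle (1 : ℝ) := fun x => ((x.out 0 : ℝ) : AddCircle (1 : ℝ))

/-- The projection `π : X → S¹ × ℝ`, `π(u) = (u₀ mod 1, u₁ − u₀)`. -/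
def piMap : X → AddCircle (1 : ℝ) × ℝ :=
  fun x => (((x.out 0 : ℝ) : AddCircle (1 : ℝ)), x.out 1 - x.out 0)

/-- The dynamics is in the depinned phase for mean spacing `ρ`: some
synchronized measure with mean spacing `ρ` has support projecting onto `S¹`. -/
def Depinned (Φ : ℝ → Conf → Conf) (ρ : ℝ) : Prop :=
  ∃ μ : Measure X, IsSyncMeasure Φ μ ∧ mSupport μ ⊆ Xrho ρ ∧
    pi0 '' mSupport μ = Set.univ

open Classical in
/-- `ℝ≥0∞`-valued indicator of a proposition. -/
def indE (p : Prop) : ℝ≥0∞ := if p then 1 else 0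

/-- `𝓘(u,v) = 1` iff `u`, `v` intersect at site `0` (i.e. in `[0,1)`). -/
def Intersects0 (u v : Conf) : Prop := IntersectAt u v 0

/-- The mean self-intersection number `𝓘(μ) = Σ_n ∫∫ 𝓘(u+n, v) dμ dμ`. -/
def meanInter (μ : Measure X) : ℝ≥0∞ :=
  ∑' n : ℤ, ∫⁻ x, ∫⁻ y, indE (Intersects0 (vshift n x.out) y.out) ∂μ ∂μ

/-- The mean self-intersection number `𝓘(μ(t))` of the evolved measure
`μ(t) = (T_t)_* μ`. -/
def meanInterAt (Φ : ℝ → Conf → Conf) (t : ℝ) (μ : Measure X) : ℝ≥0∞ :=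
  ∑' n : ℤ, ∫⁻ x, ∫⁻ y,
    indE (Intersects0 (vshift n (Tq Φ t x).out) ((Tq Φ t y).out)) ∂μ ∂μ

open Classical in
/-- The proportion of pairs `(m, n)`, `0 ≤ m ≤ N`, `−N ≤ n ≤ N`, with
`T_m S_n x ∈ U`. -/
def freq (Φ : ℝ → Conf → Conf) (x : X) (U : Set X) (N : ℕ) : ℝ :=
  ((((Finset.range (N + 1)) ×ˢ (Finset.Icc (-(N : ℤ)) (N : ℤ))).filter
      (fun p => Tq Φ (p.1 : ℝ) (Snq p.2 x) ∈ U)).card : ℝ) /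
    (((N : ℝ) + 1) * (2 * (N : ℝ) + 1))

/-- `B` is a closed set fully absorbing the space-time statistics of `x`. -/
def Absorbing (Φ : ℝ → Conf → Conf) (x : X) (B : Set X) : Prop :=
  IsClosed B ∧ ∀ U : Set X, IsOpen U → B ⊆ U →
    Tendsto (fun N => freq Φ x U N) atTop (𝓝 (1 : ℝ))

/-- The weak ω-limit set `ω̃(x)`: the smallest closed set such that for every
open neighbourhood of it the proportion of space-time translates of `x`
belonging to it tends to `1`. -/
def wOmega (Φ : ℝ → Conf → Conf) (x : X) : Set X := ⋂₀ {B : Set X | Absorbing Φ x B}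

/-- The space-time attractor `A = Cl(⋃_u ω̃(u))`. -/
def attractor (Φ : ℝ → Conf → Conf) : Set X := closure (⋃ x : X, wOmega Φ x)

/-- Translation of the argument of a function by `a`. -/
def argShift (a : ℝ) (φ : ℝ → ℝ) : ℝ → ℝ := fun x => φ (x + a)

/-- Hull functions: nondecreasing functions of degree one. -/
def IsHull (φ : ℝ → ℝ) : Prop := Monotone φ ∧ ∀ x, φ (x + 1) = φ x + 1

theorem IsHull.add_int {φ : ℝ → ℝ} (hφ : IsHull φ) (x : ℝ) (n : ℤ) : φ (x + n) = φ x + n := by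
  induction n with
  | zero => simp
  | succ k ih =>
    have h := hφ.2 (x + (k : ℤ))
    push_cast at h ih ⊢
    rw [← add_assoc, h, ih, add_assoc]
  | pred k ih =>
    have h := hφ.2 (x + ((-(k : ℤ) - 1 : ℤ) : ℝ))
    have e : x + ((-(k : ℤ) - 1 : ℤ) : ℝ) + 1 = x + ((-(k : ℤ) : ℤ) : ℝ) := by
      push_cast; ring
    rw [e, ih] at h
    push_cast at h ⊢
    linarith

theorem IsHull.abs_sub_le {φ : ℝ → ℝ} (hφ : IsHull φ) (x d : ℝ) :
    |φ (x + d) - φ x - d| ≤ 1 := by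
  have h1 : φ (x + d) ≤ φ (x + ⌈d⌉) := hφ.1 (by linarith [Int.le_ceil d])
  have h2 : φ (x + ⌊d⌋) ≤ φ (x + d) := hφ.1 (by linarith [Int.floor_le d])
  rw [hφ.add_int] at h1 h2
  have h3 := Int.ceil_lt_add_one d
  have h4 := Int.lt_floor_add_one d
  rw [abs_le]
  constructor <;> linarith

theorem isHull_id : IsHull id := ⟨monotone_id, fun _ => rfl⟩

theorem IsHull.comp_argShift {φ : ℝ → ℝ} (hφ : IsHull φ) (a : ℝ) : IsHull (argShift a φ) := by
  refine ⟨fun x y hxy => hφ.1 (by linarith), fun x => ?_⟩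
  have h := hφ.2 (x + a)
  simp only [argShift]
  rw [← h]
  congr 1
  ring

theorem IsHull.of_tendsto {F : ℕ → ℝ → ℝ} {φ : ℝ → ℝ} (hF : ∀ k, IsHull (F k))
    (h : Tendsto F atTop (𝓝 φ)) : IsHull φ := by
  rw [tendsto_pi_nhds] at h
  refine ⟨fun x y hxy => le_of_tendsto_of_tendsto' (h x) (h y) fun k => (hF k).1 hxy, fun x => ?_⟩
  refine tendsto_nhds_unique (h (x + 1)) ?_
  simpa only [(hF _).2 x] using (h x).add_const 1

/-- Order preserving operators on functions that commute with translations of the argument and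
with the addition of `1`, and are continuous for pointwise convergence. -/
structure IsHullOperator (T : (ℝ → ℝ) → ℝ → ℝ) : Prop where
  mono : Monotone T
  comm : ∀ a φ, T (argShift a φ) = argShift a (T φ)
  add_one : ∀ φ, T (fun x => φ x + 1) = fun x => T φ x + 1
  cont : Continuous T

namespace IsHullOperator

variable {T R : (ℝ → ℝ) → ℝ → ℝ}

theorem refl : IsHullOperator id :=
  ⟨monotone_id, fun _ _ => rfl, fun _ => rfl, continuous_id⟩

theorem comp (hT : IsHullOperator T) (hR : IsHullOperator R) : IsHullOperator (T ∘ R) where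
  mono := hT.mono.comp hR.mono
  comm a φ := by simp only [Function.comp, hR.comm, hT.comm]
  add_one φ := by simp only [Function.comp, hR.add_one, hT.add_one]
  cont := hT.cont.comp hR.cont

theorem argShift_op (a : ℝ) : IsHullOperator (argShift a) where
  mono := fun _ _ h x => h (x + a)
  comm b φ := by
    funext x
    simp only [argShift]
    congr 1
    ring
  add_one _ := rfl
  cont := continuous_pi fun x => continuous_apply (x + a)

theorem iterate (hT : IsHullOperator T) (k : ℕ) : IsHullOperator T^[k] := by
  induction k with
  | zero => exact refl
  | succ k ih =>
    rw [Function.iterate_succ']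
    exact hT.comp ih

theorem isHull (hT : IsHullOperator T) {φ : ℝ → ℝ} (hφ : IsHull φ) : IsHull (T φ) := by
  refine ⟨fun x y hxy => ?_, fun x => ?_⟩
  · have h := hT.mono (show φ ≤ argShift (y - x) φ from fun z => hφ.1 (by linarith)) x
    rw [hT.comm] at h
    simpa [argShift] using h
  · have h1 := congrFun (hT.comm 1 φ) x
    have h2 : argShift 1 φ = fun x => φ x + 1 := funext hφ.2
    rw [h2, hT.add_one] at h1
    exact h1.symm

end IsHullOperator

/-- A real sequence that is additive up to a bounded error is linear up to the same error. -/
theorem exists_abs_sub_mul_le {a : ℕ → ℝ} {c : ℝ} (h : ∀ k l, |a (k + l) - a k - a l| ≤ c) :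
    ∃ ν : ℝ, ∀ k : ℕ, |a k - k * ν| ≤ c := by
  have hlow : ∀ l n : ℕ, 1 ≤ n → (n : ℝ) * (a l - c) ≤ a (n * l) - c := by
    intro l n hn
    induction n, hn using Nat.le_induction with
    | base => simp
    | succ n hn ih =>
      have h1 := (abs_le.1 (h (n * l) l)).1
      rw [Nat.succ_mul]
      push_cast
      linarith
  have hup : ∀ l n : ℕ, 1 ≤ n → a (n * l) + c ≤ (n : ℝ) * (a l + c) := by
    intro l n hn
    induction n, hn using Nat.le_induction with
    | base => simp
    | succ n hn ih =>
      have h1 := (abs_le.1 (h (n * l) l)).2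
      rw [Nat.succ_mul]
      push_cast
      linarith
  have hc : 0 ≤ c := (abs_nonneg _).trans (h 0 0)
  have hcross : ∀ k l : ℕ, 1 ≤ k → 1 ≤ l → (a k - c) / k ≤ (a l + c) / l := by
    intro k l hk hl
    have h1 := hlow k l hl
    have h2 := hup l k hk
    rw [mul_comm l k] at h1
    have hk' : (0 : ℝ) < k := by exact_mod_cast hk
    have hl' : (0 : ℝ) < l := by exact_mod_cast hl
    rw [div_le_div_iff₀ hk' hl']
    linarith
  let S : Set ℝ := {x | ∃ k : ℕ, 1 ≤ k ∧ x = (a k - c) / k}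
  have hne : S.Nonempty := ⟨_, 1, le_rfl, rfl⟩
  have hbd : BddAbove S := by
    refine ⟨(a 1 + c) / (1 : ℕ), ?_⟩
    rintro x ⟨k, hk, rfl⟩
    exact hcross k 1 hk le_rfl
  refine ⟨sSup S, fun k => ?_⟩
  rcases Nat.eq_zero_or_pos k with rfl | hk
  · have := h 0 0
    rw [abs_le] at this ⊢
    simp only [add_zero, Nat.cast_zero, zero_mul] at this ⊢
    constructor <;> linarith
  · have hk' : (0 : ℝ) < k := by exact_mod_cast hk
    have h1 : (a k - c) / k ≤ sSup S := le_csSup hbd ⟨k, hk, rfl⟩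
    have h2 : sSup S ≤ (a k + c) / k := by
      refine csSup_le hne ?_
      rintro x ⟨l, hl, rfl⟩
      exact hcross l k hl hk
    rw [div_le_iff₀ hk'] at h1
    rw [le_div_iff₀ hk'] at h2
    rw [abs_le]
    constructor <;> linarith

theorem argShift_iterate (a : ℝ) (k : ℕ) (φ : ℝ → ℝ) :
    (argShift a)^[k] φ = argShift (k * a) φ := by
  induction k with
  | zero => funext x; simp [argShift]
  | succ k ih =>
    rw [Function.iterate_succ_apply', ih]
    funext x
    simp only [argShift]
    congr 1
    push_cast
    ring

namespace IsHullOperator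

variable {T : (ℝ → ℝ) → ℝ → ℝ}

theorem abs_iterate_add_sub_le (hT : IsHullOperator T) (k l : ℕ) :
    |T^[k + l] id 0 - T^[k] id 0 - T^[l] id 0| ≤ 2 := by
  have hl := (hT.iterate l).isHull isHull_id
  have hk := (hT.iterate k).isHull isHull_id
  have hu : T^[l] id ≤ argShift (T^[l] id 0 + 1) id := fun x => by
    have := (abs_le.1 (hl.abs_sub_le 0 x)).2
    simp only [argShift, id, zero_add] at this ⊢
    linarith
  have hd : argShift (T^[l] id 0 - 1) id ≤ T^[l] id := fun x => by
    have := (abs_le.1 (hl.abs_sub_le 0 x)).1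
    simp only [argShift, id, zero_add] at this ⊢
    linarith
  have h1 := (hT.iterate k).mono hu 0
  have h2 := (hT.iterate k).mono hd 0
  rw [(hT.iterate k).comm, ← Function.iterate_add_apply] at h1 h2
  simp only [argShift] at h1 h2
  have h3 := (abs_le.1 (hk.abs_sub_le 0 (T^[l] id 0 + 1))).2
  have h4 := (abs_le.1 (hk.abs_sub_le 0 (T^[l] id 0 - 1))).1
  rw [abs_le]
  constructor <;> linarith

theorem exists_isHull_fixed_of_bounded (hT : IsHullOperator T) {c : ℝ}
    (hc : ∀ k x, |T^[k] id x - x| ≤ c) : ∃ φ, IsHull φ ∧ T φ = φ := by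
  have hbu : ∀ k x, T^[k] id x ≤ x + c := fun k x => by linarith [(abs_le.1 (hc k x)).2]
  have hbl : ∀ k x, x - c ≤ T^[k] id x := fun k x => by linarith [(abs_le.1 (hc k x)).1]
  have hhull : ∀ k, IsHull (T^[k] id) := fun k => (hT.iterate k).isHull isHull_id
  let s : ℕ → ℝ → ℝ := fun K x => ⨆ k, T^[K + k] id x
  have hbdd : ∀ K x, BddAbove (Set.range fun k => T^[K + k] id x) := fun K x =>
    ⟨x + c, by rintro _ ⟨k, rfl⟩; exact hbu _ _⟩
  have hs_ge : ∀ K k, T^[K + k] id ≤ s K := fun K k x => le_ciSup (hbdd K x) k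
  have hs_le : ∀ K x, s K x ≤ x + c := fun K x => ciSup_le fun k => hbu _ _
  have hs_lb : ∀ K x, x - c ≤ s K x := fun K x => (hbl _ _).trans (hs_ge K 0 x)
  have hs_hull : ∀ K, IsHull (s K) := by
    refine fun K => ⟨fun x y hxy => ciSup_le fun k => ((hhull _).1 hxy).trans (hs_ge K k y),
      fun x => le_antisymm (ciSup_le fun k => ?_) ?_⟩
    · rw [(hhull _).2]
      linarith [hs_ge K k x]
    · rw [← le_sub_iff_add_le]
      refine ciSup_le fun k => ?_
      rw [le_sub_iff_add_le, ← (hhull _).2]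
      exact hs_ge K k (x + 1)
  have hs_anti : ∀ x, Antitone fun K => s K x := by
    intro x K L hKL
    refine ciSup_le fun k => ?_
    obtain ⟨d, rfl⟩ := Nat.exists_eq_add_of_le hKL
    rw [add_assoc]
    exact hs_ge K (d + k) x
  let ψ : ℝ → ℝ := fun x => ⨅ K, s K x
  have hψ : Tendsto s atTop (𝓝 ψ) := tendsto_pi_nhds.2 fun x =>
    tendsto_atTop_ciInf (hs_anti x) ⟨x - c, by rintro _ ⟨K, rfl⟩; exact hs_lb K x⟩
  have hψ_hull : IsHull ψ := .of_tendsto hs_hull hψ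
  have hψT : ψ ≤ T ψ := by
    have h1 := (tendsto_add_atTop_iff_nat 1).2 hψ
    have h2 : Tendsto (fun K => T (s K)) atTop (𝓝 (T ψ)) := (hT.cont.tendsto ψ).comp hψ
    intro x
    refine le_of_tendsto_of_tendsto' (tendsto_pi_nhds.1 h1 x) (tendsto_pi_nhds.1 h2 x) fun K => ?_
    refine ciSup_le fun k => ?_
    have h3 := hT.mono (hs_ge K k) x
    rwa [← Function.iterate_succ_apply' T, show (K + k).succ = K + 1 + k by omega] at h3
  have hψ_le : ψ ≤ argShift c id := fun x =>
    le_of_tendsto' (tendsto_pi_nhds.1 hψ x) fun K => hs_le K x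
  have hr_le : ∀ k x, T^[k] ψ x ≤ x + c + c := fun k x => by
    have h := (hT.iterate k).mono hψ_le x
    rw [(hT.iterate k).comm] at h
    exact h.trans (hbu k (x + c))
  have hr_mono : Monotone fun k => T^[k] ψ := hT.mono.monotone_iterate_of_le_map hψT
  let χ : ℝ → ℝ := fun x => ⨆ k, T^[k] ψ x
  have hχ : Tendsto (fun k => T^[k] ψ) atTop (𝓝 χ) := tendsto_pi_nhds.2 fun x =>
    tendsto_atTop_ciSup (fun k l hkl => hr_mono hkl x)
      ⟨x + c + c, by rintro _ ⟨k, rfl⟩; exact hr_le k x⟩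
  refine ⟨χ, .of_tendsto (fun k => (hT.iterate k).isHull hψ_hull) hχ, ?_⟩
  have h1 := (tendsto_add_atTop_iff_nat 1).2 hχ
  have h2 : Tendsto (fun k => T (T^[k] ψ)) atTop (𝓝 (T χ)) := (hT.cont.tendsto χ).comp hχ
  refine tendsto_nhds_unique h2 ?_
  simpa only [Function.iterate_succ_apply'] using h1

/-- Every hull operator has a travelling wave, normalized at the origin. -/
theorem exists_wave (hT : IsHullOperator T) :
    ∃ φ ν, IsHull φ ∧ T φ = argShift ν φ ∧ φ 0 ∈ Set.Icc (0 : ℝ) 1 := by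
  obtain ⟨ν, hν⟩ := exists_abs_sub_mul_le (a := fun k => T^[k] id 0) hT.abs_iterate_add_sub_le
  have hG : IsHullOperator (argShift (-ν) ∘ T) := (IsHullOperator.argShift_op _).comp hT
  obtain ⟨φ, hφ, hfix⟩ := hG.exists_isHull_fixed_of_bounded (c := 3) (by
    intro k x
    have hcomm : Function.Commute (argShift (-ν)) T := fun φ =>
      (hT.comm _ φ).symm
    rw [hcomm.comp_iterate, Function.comp_apply, argShift_iterate]
    have h1 := abs_le.1 (((hT.iterate k).isHull isHull_id).abs_sub_le 0 (x + k * -ν))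
    have h2 := abs_le.1 (hν k)
    simp only [argShift, zero_add] at h1 ⊢
    rw [abs_le]
    constructor <;> linarith)
  have hwave : T φ = argShift ν φ := by
    conv_rhs => rw [← hfix]
    funext x
    simp [argShift]
  have hadd : argShift ((-⌊φ 0⌋ : ℤ) : ℝ) φ 0 = φ 0 - ⌊φ 0⌋ := by
    simp only [argShift]
    rw [hφ.add_int]
    push_cast
    ring
  refine ⟨argShift ((-⌊φ 0⌋ : ℤ) : ℝ) φ, ν, hφ.comp_argShift _, ?_, ?_⟩
  · rw [hT.comm, hwave, (IsHullOperator.argShift_op ν).comm]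
  · rw [hadd]
    exact ⟨by linarith [Int.floor_le (φ 0)], by linarith [Int.lt_floor_add_one (φ 0)]⟩

end IsHullOperator

/-- One step of the explicit Euler scheme for the dynamics of hull functions. -/
def eulerStep (g a : ℝ → ℝ) (ρ h c : ℝ) (φ : ℝ → ℝ) : ℝ → ℝ := fun x =>
  φ x + h * (g (φ (x + ρ) - φ x) - g (φ x - φ (x - ρ)) + a (φ x) + c)

/-- Composition of the first `k` Euler steps with the forces `c 0, …, c (k - 1)`. -/
def eulerIterate (g a : ℝ → ℝ) (ρ h : ℝ) (c : ℤ → ℝ) : ℕ → (ℝ → ℝ) → ℝ → ℝ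
  | 0 => id
  | k + 1 => eulerStep g a ρ h (c k) ∘ eulerIterate g a ρ h c k

theorem isHullOperator_eulerStep {g a : ℝ → ℝ} {K L h : ℝ} (ρ c : ℝ) (hg : Monotone g)
    (hgK : ∀ x y, |g x - g y| ≤ K * |x - y|) (ha : ∀ x, a (x + 1) = a x)
    (haL : ∀ x y, |a x - a y| ≤ L * |x - y|) (h0 : 0 ≤ h) (hKL : h * (2 * K + L) ≤ 1) :
    IsHullOperator (eulerStep g a ρ h c) where
  mono := by
    intro φ ψ hφψ x
    have hy := hφψ x
    have hp := hφψ (x + ρ)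
    have hq := hφψ (x - ρ)
    simp only [eulerStep]
    generalize φ x = y, ψ x = y', φ (x + ρ) = p, ψ (x + ρ) = p', φ (x - ρ) = q,
      ψ (x - ρ) = q' at *
    have h1 : g (p - y) ≤ g (p' - y) := hg (by linarith)
    have h2 := (abs_le.1 (hgK (p' - y) (p' - y'))).2
    have h3 : g (y' - q') ≤ g (y' - q) := hg (by linarith)
    have h4 := (abs_le.1 (hgK (y' - q) (y - q))).2
    have h5 := (abs_le.1 (haL y y')).2
    rw [show p' - y - (p' - y') = y' - y by ring, abs_of_nonneg (sub_nonneg.2 hy)] at h2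
    rw [show y' - q - (y - q) = y' - y by ring, abs_of_nonneg (sub_nonneg.2 hy)] at h4
    rw [abs_sub_comm, abs_of_nonneg (sub_nonneg.2 hy)] at h5
    have h6 : (g (p - y) - g (y - q) + a y + c) - (g (p' - y') - g (y' - q') + a y' + c)
        ≤ (2 * K + L) * (y' - y) := by linarith
    have h7 := mul_le_mul_of_nonneg_left h6 h0
    have h8 := mul_le_mul_of_nonneg_right hKL (sub_nonneg.2 hy)
    linarith
  comm b φ := by
    funext x
    simp only [eulerStep, argShift]
    rw [show x + ρ + b = x + b + ρ by ring, show x - ρ + b = x + b - ρ by ring]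
  add_one φ := by
    funext x
    simp only [eulerStep, add_sub_add_right_eq_sub, ha]
    ring
  cont := by
    have hgc : Continuous g := (LipschitzWith.of_dist_le_mul (K := K.toNNReal) fun x y =>
      (hgK x y).trans (mul_le_mul_of_nonneg_right (Real.le_coe_toNNReal K)
        (abs_nonneg _))).continuous
    have hac : Continuous a := (LipschitzWith.of_dist_le_mul (K := L.toNNReal) fun x y =>
      (haL x y).trans (mul_le_mul_of_nonneg_right (Real.le_coe_toNNReal L)
        (abs_nonneg _))).continuous
    unfold eulerStep
    fun_prop

/-- The Euler scheme with `N` time steps per period has an entire solution whose space-time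
translates are totally ordered. -/
theorem exists_discrete_synchronized {g a : ℝ → ℝ} {K L : ℝ} {c : ℤ → ℝ} {N : ℕ} (ρ : ℝ)
    (hg : Monotone g) (hgK : ∀ x y, |g x - g y| ≤ K * |x - y|) (ha : ∀ x, a (x + 1) = a x)
    (haL : ∀ x y, |a x - a y| ≤ L * |x - y|) (hN : 0 < N) (hKL : 2 * K + L ≤ N)
    (hc : ∀ i, c (i + N) = c i) :
    ∃ v : ℤ → Conf,
      (∀ i j, v (i + 1) j = v i j + (1 / (N : ℝ)) *
        (g (v i (j + 1) - v i j) - g (v i j - v i (j - 1)) + a (v i j) + c i)) ∧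
      (∀ i m n, |v i m - v i n - ((m - n : ℤ) : ℝ) * ρ| ≤ 1) ∧
      v 0 0 ∈ Set.Icc (0 : ℝ) 1 ∧
      ∀ m n s : ℤ, (∀ i j, v i j ≤ v (i + s * N) (j - m) + n) ∨
        (∀ i j, v (i + s * N) (j - m) + n ≤ v i j) := by
  have hN' : (0 : ℝ) < N := by exact_mod_cast hN
  have hNZ : (0 : ℤ) < N := by exact_mod_cast hN
  set h : ℝ := 1 / (N : ℝ) with hh
  have h0 : 0 ≤ h := by positivity
  have hKL' : h * (2 * K + L) ≤ 1 := by
    rw [hh, one_div, inv_mul_le_iff₀ hN']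
    linarith
  have hstep := fun c : ℝ => isHullOperator_eulerStep ρ c hg hgK ha haL h0 hKL'
  have hiter : ∀ k, IsHullOperator (eulerIterate g a ρ h c k) := by
    intro k
    induction k with
    | zero => exact .refl
    | succ k ih => exact (hstep _).comp ih
  obtain ⟨φ, ν, hφ, hwave, h01⟩ := (hiter N).exists_wave
  let Φ : ℤ → ℝ → ℝ := fun i =>
    argShift ((i / N : ℤ) * ν) (eulerIterate g a ρ h c (i % N).toNat φ)
  have hΦ : ∀ i, IsHull (Φ i) := fun i => ((hiter _).isHull hφ).comp_argShift _
  have hcper : Function.Periodic c (N : ℤ) := hc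
  have hΦ_succ : ∀ i, Φ (i + 1) = eulerStep g a ρ h (c i) (Φ i) := by
    intro i
    have hr0 := Int.emod_nonneg i hNZ.ne'
    have hr1 := Int.emod_lt_of_pos i hNZ
    have hdecomp := Int.emod_add_mul_ediv i N
    have hci : c ((i % N).toNat : ℤ) = c i := by
      rw [Int.toNat_of_nonneg hr0, Int.emod_def, mul_comm]
      exact hcper.sub_int_mul_eq (i / N)
    have hrec : eulerStep g a ρ h (c i) (Φ i) = argShift ((i / N : ℤ) * ν)
        (eulerIterate g a ρ h c ((i % N).toNat + 1) φ) := by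
      simp only [Φ]
      rw [(hstep _).comm, ← hci]
      rfl
    rw [hrec]
    rcases lt_or_ge (i % N + 1) N with hlt | hge
    · have hm : (i + 1) % N = i % N + 1 := by
        rw [← hdecomp, show i % N + N * (i / N) + 1 = (i % N + 1) + N * (i / N) by ring,
          Int.add_mul_emod_self_left, Int.emod_eq_of_lt (by omega) hlt, hdecomp]
      have hd : (i + 1) / N = i / N := by
        conv_lhs => rw [← hdecomp, show i % N + N * (i / N) + 1 = (i % N + 1) + N * (i / N) by ring,
          Int.add_mul_ediv_left _ _ hNZ.ne', Int.ediv_eq_zero_of_lt (by omega) hlt, zero_add]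
      simp only [Φ]
      rw [hm, hd, Int.toNat_add hr0 zero_le_one]
      rfl
    · have he : i % N + 1 = N := by omega
      have hi : i + 1 = N * (i / N + 1) := by linarith
      have hm : (i + 1) % N = 0 := by rw [hi]; exact Int.mul_emod_right _ _
      have hd : (i + 1) / N = i / N + 1 := by
        rw [hi]; exact Int.mul_ediv_cancel_left _ hNZ.ne'
      have hk : (i % N).toNat + 1 = N := by omega
      simp only [Φ]
      rw [hm, hd, hk, hwave]
      funext x
      simp only [argShift, eulerIterate, Int.toNat_zero, id]
      congr 1
      push_cast
      ring
  have hΦ_per : ∀ i s : ℤ, Φ (i + s * N) = argShift (s * ν) (Φ i) := by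
    intro i s
    simp only [Φ]
    rw [Int.add_mul_emod_self_right, Int.add_mul_ediv_right _ _ hNZ.ne']
    funext x
    simp only [argShift]
    congr 1
    push_cast
    ring
  refine ⟨fun i j => Φ i (j * ρ), fun i j => ?_, fun i m n => ?_, ?_, fun m n s => ?_⟩
  · simp only [hΦ_succ, eulerStep]
    rw [show ((j + 1 : ℤ) : ℝ) * ρ = j * ρ + ρ by push_cast; ring,
      show ((j - 1 : ℤ) : ℝ) * ρ = j * ρ - ρ by push_cast; ring]
  · have h1 := (hΦ i).abs_sub_le (n * ρ) ((m - n : ℤ) * ρ)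
    rwa [show (n : ℝ) * ρ + (m - n : ℤ) * ρ = m * ρ by push_cast; ring] at h1
  · simpa [Φ, argShift, eulerIterate] using h01
  · have hshift : ∀ i j : ℤ, Φ (i + s * N) ((j - m : ℤ) * ρ) + n =
        Φ i (j * ρ + (s * ν - m * ρ + n)) := by
      intro i j
      rw [hΦ_per, ← (hΦ i).comp_argShift (s * ν) |>.add_int]
      simp only [argShift]
      congr 1
      push_cast
      ring
    simp only [hshift]
    rcases le_total 0 (s * ν - m * ρ + n) with hd | hd
    · exact .inl fun i j => (hΦ i).1 (by linarith)
    · exact .inr fun i j => (hΦ i).1 (by linarith)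

namespace FKModel

variable (M : FKModel)

theorem continuous_deriv_W : Continuous (deriv M.W) :=
  M.W_smooth.continuous_deriv (by norm_num)

theorem continuous_deriv_V : Continuous (deriv M.V) :=
  M.V_smooth.continuous_deriv le_rfl

theorem strictMono_deriv_W : StrictMono (deriv M.W) := by
  obtain ⟨δ, hδ, h⟩ := M.W_convex
  exact strictMono_of_deriv_pos fun x => hδ.trans_le (h x)

theorem continuous_f : Continuous M.f := by
  rcases M.f_force with ⟨c, hc⟩ | h
  · rw [show M.f = fun _ => c from funext hc]
    exact continuous_const
  · exact h.1

theorem periodic_f : Function.Periodic M.f 1 := by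
  rcases M.f_force with ⟨c, hc⟩ | h
  · intro t
    rw [hc, hc]
  · exact h.2

theorem periodic_deriv_V : Function.Periodic (deriv M.V) 1 := by
  intro x
  rw [← deriv_comp_add_const, funext M.V_periodic]

end FKModel

theorem exists_abs_le_of_periodic {f : ℝ → ℝ} (hf : Continuous f) (hp : Function.Periodic f 1) :
    ∃ B, ∀ x, |f x| ≤ B := by
  obtain ⟨B, hB⟩ := (hp.isBounded_of_continuous one_ne_zero hf).exists_norm_le
  exact ⟨B, fun x => hB _ ⟨x, rfl⟩⟩

theorem exists_slope_eq_deriv {V : ℝ → ℝ} (hV : Differentiable ℝ V) (x : ℝ) {r : ℝ} (hr : 0 < r) :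
    ∃ ξ, |ξ - x| ≤ r ∧ r⁻¹ * (V (x + r) - V x) = deriv V ξ := by
  obtain ⟨ξ, ⟨h1, h2⟩, h⟩ := exists_deriv_eq_slope V (show x < x + r by linarith)
    hV.continuous.continuousOn hV.differentiableOn
  refine ⟨ξ, abs_le.2 ⟨by linarith, by linarith⟩, ?_⟩
  rw [h, add_sub_cancel_left, div_eq_inv_mul]

/-- On a compact interval, a nondecreasing `C¹` function agrees with a globally Lipschitz
nondecreasing one. -/
theorem exists_monotone_lipschitz_eqOn {w : ℝ → ℝ} (hw : ContDiff ℝ 1 w) (hm : Monotone w)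
    (b c : ℝ) : ∃ g K, Monotone g ∧ (∀ x y, |g x - g y| ≤ K * |x - y|) ∧
      Set.EqOn g w (Set.Icc b c) := by
  rcases lt_or_ge c b with hbc | hbc
  · exact ⟨fun _ => 0, 0, monotone_const, by simp, by simp [Set.Icc_eq_empty hbc.not_ge]⟩
  obtain ⟨K, hK⟩ := hw.contDiffOn.exists_lipschitzOnWith one_ne_zero (convex_Icc b c) isCompact_Icc
  refine ⟨fun x => w (Set.projIcc b c hbc x), K, fun x y hxy => hm (Set.monotone_projIcc hbc hxy),
    fun x y => ?_, fun x hx => by simp [Set.projIcc_of_mem hbc hx]⟩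
  have h1 := hK.dist_le_mul _ (Set.projIcc b c hbc x).2 _ (Set.projIcc b c hbc y).2
  have h2 := (LipschitzWith.projIcc hbc).dist_le_mul x y
  rw [NNReal.coe_one, one_mul] at h2
  exact h1.trans (mul_le_mul_of_nonneg_left h2 K.2)

/-- Approximate synchronized solutions, with time step `1 / N n` and with the on-site force
evaluated at a point within distance `1 / (n + 1)`. -/
theorem exists_approximate_solutions (M : FKModel) (ρ : ℝ) (n : ℕ) :
    ∃ (N : ℕ) (v : ℤ → Conf), n + 1 ≤ N ∧
      (∀ i j, ∃ ξ, |ξ - v i j| ≤ 1 / ((n : ℝ) + 1) ∧ v (i + 1) j - v i j = (1 / (N : ℝ)) *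
        (deriv M.W (v i (j + 1) - v i j) - deriv M.W (v i j - v i (j - 1)) + deriv M.V ξ
          + M.f (i / N))) ∧
      (∀ i m n, |v i m - v i n - ((m - n : ℤ) : ℝ) * ρ| ≤ 1) ∧
      v 0 0 ∈ Set.Icc (0 : ℝ) 1 ∧
      ∀ m n s : ℤ, (∀ i j, v i j ≤ v (i + s * N) (j - m) + n) ∨
        (∀ i j, v (i + s * N) (j - m) + n ≤ v i j) := by
  obtain ⟨g, K, hg, hgK, hgW⟩ := exists_monotone_lipschitz_eqOn
    (w := deriv M.W) (ContDiff.deriv' (n := 1) (by rw [one_add_one_eq_two]; exact M.W_smooth)) M.strictMono_deriv_W.monotone (ρ - 1) (ρ + 1)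
  obtain ⟨B, hB⟩ := exists_abs_le_of_periodic M.continuous_deriv_V M.periodic_deriv_V
  have hVd : Differentiable ℝ M.V := M.V_smooth.differentiable one_ne_zero
  have hVL : ∀ x y, |M.V x - M.V y| ≤ B * |x - y| := fun x y =>
    convex_univ.norm_image_sub_le_of_norm_deriv_le (fun z _ => hVd z) (fun z _ => hB z)
      (Set.mem_univ y) (Set.mem_univ x)
  set r : ℝ := 1 / ((n : ℝ) + 1) with hr
  have hr0 : 0 < r := by positivity
  let a : ℝ → ℝ := fun x => r⁻¹ * (M.V (x + r) - M.V x)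
  have haper : ∀ x, a (x + 1) = a x := fun x => by
    simp only [a, M.V_periodic, show x + 1 + r = x + r + 1 by ring]
  have haL : ∀ x y, |a x - a y| ≤ r⁻¹ * (2 * B) * |x - y| := by
    intro x y
    have h1 := hVL (x + r) (y + r)
    have h2 := hVL x y
    rw [add_sub_add_right_eq_sub] at h1
    rw [show a x - a y = r⁻¹ * ((M.V (x + r) - M.V (y + r)) - (M.V x - M.V y)) by
      simp only [a]; ring, abs_mul, abs_of_pos (inv_pos.2 hr0), mul_assoc]
    refine mul_le_mul_of_nonneg_left ((abs_sub _ _).trans ?_) (inv_pos.2 hr0).le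
    linarith
  obtain ⟨N₀, hN₀⟩ := exists_nat_ge (2 * K + r⁻¹ * (2 * B))
  set N := max N₀ (n + 1) with hNdef
  have hN : 0 < N := by omega
  have hN' : (N : ℝ) ≠ 0 := by positivity
  obtain ⟨v, hv, hbw, h01, hord⟩ := exists_discrete_synchronized (c := fun i => M.f (i / N)) ρ hg
    hgK haper haL hN (hN₀.trans (by exact_mod_cast le_max_left _ _)) (by
      intro i
      have h := M.periodic_f (i / N)
      rw [← h]
      congr 1
      push_cast
      field_simp)
  refine ⟨N, v, le_max_right _ _, fun i j => ?_, hbw, h01, hord⟩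
  obtain ⟨ξ, hξ, hs⟩ := exists_slope_eq_deriv hVd (v i j) hr0
  refine ⟨ξ, hξ, ?_⟩
  have hmem : ∀ k : ℤ, v i (k + 1) - v i k ∈ Set.Icc (ρ - 1) (ρ + 1) := fun k => by
    have h := abs_le.1 (hbw i (k + 1) k)
    rw [show ((k + 1 - k : ℤ) : ℝ) * ρ = ρ by push_cast; ring] at h
    exact ⟨by linarith, by linarith⟩
  have hm := hmem (j - 1)
  rw [sub_add_cancel] at hm
  rw [hv, ← hgW (hmem j), ← hgW hm, ← hs]
  ring

theorem abs_sub_sub_mul_le_of_increments {w : ℤ → ℝ} {A e : ℝ} {a b : ℤ}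
    (h : ∀ i, min a b ≤ i → i < max a b → |w (i + 1) - w i - A| ≤ e) :
    |w b - w a - ((b - a : ℤ) : ℝ) * A| ≤ |((b - a : ℤ) : ℝ)| * e := by
  have key : ∀ a b : ℤ, a ≤ b → (∀ i, a ≤ i → i < b → |w (i + 1) - w i - A| ≤ e) →
      |w b - w a - ((b - a : ℤ) : ℝ) * A| ≤ ((b - a : ℤ) : ℝ) * e := by
    intro a b hab
    induction b, hab using Int.leInduction with
    | base => intro _; simp
    | succ b hab ih =>
      intro h
      have h1 := ih fun i hi hib => h i hi (by omega)
      have h2 := h b hab (by omega)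
      rw [abs_le] at h1 h2 ⊢
      push_cast at h1 ⊢
      constructor <;> linarith
  rcases le_total a b with hab | hab
  · rw [min_eq_left hab, max_eq_right hab] at h
    have h1 := key a b hab h
    have h2 : (0 : ℝ) ≤ ((b - a : ℤ) : ℝ) := by exact_mod_cast sub_nonneg.2 hab
    rwa [abs_of_nonneg h2]
  · rw [min_eq_right hab, max_eq_left hab] at h
    have h1 := key b a hab h
    rw [abs_sub_comm] at h1
    have h2 : |((b - a : ℤ) : ℝ)| = ((a - b : ℤ) : ℝ) := by
      rw [← abs_neg, abs_of_nonneg] <;> push_cast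
      · ring
      · have : (b : ℝ) ≤ a := by exact_mod_cast hab
        linarith
    rw [h2]
    convert h1 using 2
    push_cast
    ring

theorem abs_floor_mul_div_sub_le (t : ℝ) {N : ℕ} (hN : 0 < N) :
    |(⌊t * N⌋ : ℝ) / N - t| ≤ 1 / N := by
  have hN' : (0 : ℝ) < N := by exact_mod_cast hN
  have h1 := Int.floor_le (t * N)
  have h2 := Int.lt_floor_add_one (t * N)
  rw [abs_le, div_sub' hN'.ne', le_div_iff₀ hN', ← neg_div, div_le_div_iff_of_pos_right hN',
    div_mul_cancel₀ _ hN'.ne']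
  constructor <;> linarith

/-- A solution for all times whose space-time translates are totally ordered. -/
theorem exists_entire_ordered (M : FKModel) (ρ : ℝ) :
    ∃ u : ℝ → Conf, IsSolution M u ∧ (∀ t, BW ρ (u t)) ∧
      ∀ m n s : ℤ, (∀ t j, u t j ≤ Smn m n (u (t + s)) j) ∨
        (∀ t j, Smn m n (u (t + s)) j ≤ u t j) := by
  choose N v hN hstep hbw h01 hord using exists_approximate_solutions M ρ
  have hNpos : ∀ n, 0 < N n := fun n => (Nat.succ_pos n).trans_le (hN n)
  have hNpos' : ∀ n, (0 : ℝ) < N n := fun n => by exact_mod_cast hNpos n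
  have hN_le : ∀ n, 1 / (N n : ℝ) ≤ 1 / ((n : ℝ) + 1) := fun n =>
    one_div_le_one_div_of_le (by positivity) (by exact_mod_cast hN n)
  have hN_le1 : ∀ n, 1 / (N n : ℝ) ≤ 1 := fun n => (hN_le n).trans (by
    rw [div_le_one (by positivity)]
    linarith [n.cast_nonneg (α := ℝ)])
  obtain ⟨B, hB0, hB⟩ : ∃ B, 0 ≤ B ∧ ∀ n i j, |v n (i + 1) j - v n i j| ≤ B * (1 / N n) := by
    obtain ⟨B₁, hB₁⟩ := (isCompact_Icc (a := ρ - 1) (b := ρ + 1)).exists_bound_of_continuousOn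
      M.continuous_deriv_W.continuousOn
    obtain ⟨B₂, hB₂⟩ := exists_abs_le_of_periodic M.continuous_deriv_V M.periodic_deriv_V
    obtain ⟨B₃, hB₃⟩ := exists_abs_le_of_periodic M.continuous_f M.periodic_f
    have h0₁ := (norm_nonneg _).trans (hB₁ ρ ⟨by linarith, by linarith⟩)
    have h0₂ := (abs_nonneg _).trans (hB₂ 0)
    have h0₃ := (abs_nonneg _).trans (hB₃ 0)
    refine ⟨B₁ + B₁ + B₂ + B₃, by positivity, fun n i j => ?_⟩
    obtain ⟨ξ, -, h⟩ := hstep n i j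
    have hmem : ∀ k : ℤ, v n i (k + 1) - v n i k ∈ Set.Icc (ρ - 1) (ρ + 1) := fun k => by
      have h := abs_le.1 (hbw n i (k + 1) k)
      rw [show ((k + 1 - k : ℤ) : ℝ) * ρ = ρ by push_cast; ring] at h
      exact ⟨by linarith, by linarith⟩
    have hm := hmem (j - 1)
    rw [sub_add_cancel] at hm
    have h1 := abs_le.1 (hB₁ _ (hmem j))
    have h2 := abs_le.1 (hB₁ _ hm)
    have h3 := abs_le.1 (hB₂ ξ)
    have h4 := abs_le.1 (hB₃ (i / N n))
    rw [h, abs_mul, abs_of_nonneg (one_div_nonneg.2 (hNpos' n).le), mul_comm]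
    refine mul_le_mul_of_nonneg_right ?_ (one_div_nonneg.2 (hNpos' n).le)
    rw [abs_le]
    constructor <;> linarith
  have hLip : ∀ n i k j, |v n k j - v n i j| ≤ |((k - i : ℤ) : ℝ)| * (B * (1 / N n)) := by
    intro n i k j
    simpa using abs_sub_sub_mul_le_of_increments (w := fun i => v n i j) (A := 0)
      (e := B * (1 / N n)) (a := i) (b := k) fun l _ _ => by simpa using hB n l j
  have hLip' : ∀ n i k j, |v n k j - v n i j| ≤ B * |(k : ℝ) / N n - i / N n| := by
    intro n i k j
    refine (hLip n i k j).trans_eq ?_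
    rw [← sub_div, abs_div, abs_of_pos (hNpos' n)]
    push_cast
    ring
  have hlim : ∀ (t : ℝ) (j : ℤ), ∃ y, Tendsto (fun n => v n ⌊t * N n⌋ j) (hyperfilter ℕ) (𝓝 y) := by
    intro t j
    let C := B * (1 + |t|) + 1 + |(j : ℝ) * ρ| + 1
    have hC : ∀ n, v n ⌊t * N n⌋ j ∈ Set.Icc (-C) C := by
      intro n
      have h1 := hLip' n 0 ⌊t * N n⌋ j
      rw [Int.cast_zero, zero_div, sub_zero] at h1
      have h2 := abs_floor_mul_div_sub_le t (hNpos n)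
      have h3 : |(⌊t * N n⌋ : ℝ) / N n| ≤ 1 + |t| := by
        have := abs_sub_abs_le_abs_sub ((⌊t * N n⌋ : ℝ) / N n) t
        linarith [hN_le1 n]
      have h4 := abs_le.1 (h1.trans (mul_le_mul_of_nonneg_left h3 hB0))
      have h5 := abs_le.1 (hbw n 0 j 0)
      rw [sub_zero] at h5
      have h6 := abs_le.1 (le_refl |(j : ℝ) * ρ|)
      have h7 := h01 n
      constructor <;> simp only [C] <;> linarith [h7.1, h7.2]
    obtain ⟨y, -, hy⟩ := (isCompact_Icc (a := -C) (b := C)).ultrafilter_le_nhds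
      ((hyperfilter ℕ).map fun n => v n ⌊t * N n⌋ j)
      (le_principal_iff.2 (Filter.mem_map.2 (Eventually.of_forall hC)))
    exact ⟨y, hy⟩
  choose u hu using hlim
  have hsmall : ∀ ε > (0 : ℝ), ∀ᶠ n : ℕ in hyperfilter ℕ, 1 / ((n : ℝ) + 1) < ε := by
    intro ε hε
    exact Nat.hyperfilter_le_atTop
      ((tendsto_one_div_add_atTop_nhds_zero_nat (𝕜 := ℝ)).eventually_lt_const hε)
  have hfloor : ∀ t : ℝ, Tendsto (fun n => (⌊t * N n⌋ : ℝ) / N n) (hyperfilter ℕ) (𝓝 t) := by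
    intro t
    rw [Metric.tendsto_nhds]
    intro ε hε
    filter_upwards [hsmall ε hε] with n hn
    exact (abs_floor_mul_div_sub_le t (hNpos n)).trans_lt ((hN_le n).trans_lt hn)
  refine ⟨u, fun t j => ?_, fun t => ⟨1, one_pos, fun m n => ?_⟩, fun m n s => ?_⟩
  · set F := M.rhs t (u t) j with hF
    have hlocal : ∀ ε > (0 : ℝ), ∃ δ > 0, ∀ᶠ n in (hyperfilter ℕ : Filter ℕ), ∀ i : ℤ,
        |(i : ℝ) / N n - t| ≤ δ → |v n (i + 1) j - v n i j - 1 / N n * F| ≤ 1 / N n * ε := by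
      intro ε hε
      let H : ℝ × ℝ × ℝ × ℝ × ℝ → ℝ := fun z => deriv M.W (z.1 - z.2.1) -
        deriv M.W (z.2.1 - z.2.2.1) + deriv M.V z.2.2.2.1 + M.f z.2.2.2.2
      have hH : Continuous H := by
        have h1 := M.continuous_deriv_W
        have h2 := M.continuous_deriv_V
        have h3 := M.continuous_f
        fun_prop
      obtain ⟨η, hη, hηH⟩ := Metric.continuous_iff.1 hH
        (u t (j + 1), u t j, u t (j - 1), u t j, t) ε hε
      have hB1 : 0 < B + 1 := by linarith
      refine ⟨η / (4 * (B + 1)), by positivity, ?_⟩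
      have hclose : ∀ k, ∀ᶠ n in (hyperfilter ℕ : Filter ℕ), |v n ⌊t * N n⌋ k - u t k| < η / 4 :=
        fun k => Metric.tendsto_nhds.1 (hu t k) (η / 4) (by positivity)
      filter_upwards [hclose (j + 1), hclose j, hclose (j - 1),
        hsmall (η / (4 * (B + 1))) (by positivity)] with n hn1 hn2 hn3 hn4 i hi
      have hfl := (abs_floor_mul_div_sub_le t (hNpos n)).trans ((hN_le n).trans hn4.le)
      have hBη : (B + 1) * (η / (4 * (B + 1))) = η / 4 := by field_simp
      have hδ4 : η / (4 * (B + 1)) ≤ η / 4 := by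
        rw [← hBη]
        nlinarith [show 0 ≤ B * (η / (4 * (B + 1))) by positivity]
      have hvi : ∀ k, |v n ⌊t * N n⌋ k - u t k| < η / 4 → |v n i k - u t k| < 3 * η / 4 := by
        intro k hk
        have h1 : |(i : ℝ) / N n - ⌊t * N n⌋ / N n| ≤ 2 * (η / (4 * (B + 1))) := by
          rw [abs_le] at hi hfl ⊢
          constructor <;> linarith
        have h2 := (hLip' n ⌊t * N n⌋ i k).trans (mul_le_mul_of_nonneg_left h1 hB0)
        have h3 : B * (2 * (η / (4 * (B + 1)))) ≤ η / 2 := by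
          nlinarith [show 0 ≤ η / (4 * (B + 1)) by positivity]
        have h4 := h2.trans h3
        rw [abs_lt] at hk ⊢
        rw [abs_le] at h4
        constructor <;> linarith
      obtain ⟨ξ, hξ, hinc⟩ := hstep n i j
      have hξ' : |ξ - u t j| < η := by
        have h1 := hvi j hn2
        rw [abs_lt] at h1 ⊢
        rw [abs_le] at hξ
        constructor <;> linarith
      have hdist : dist (v n i (j + 1), v n i j, v n i (j - 1), ξ, (i : ℝ) / N n)
          (u t (j + 1), u t j, u t (j - 1), u t j, t) < η := by
        simp only [Prod.dist_eq, Real.dist_eq, max_lt_iff]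
        exact ⟨(hvi _ hn1).trans (by linarith), (hvi _ hn2).trans (by linarith),
          (hvi _ hn3).trans (by linarith), hξ', by linarith⟩
      have hHi := (hηH _ hdist).le
      rw [hinc, ← mul_sub, abs_mul, abs_of_nonneg (one_div_nonneg.2 (hNpos' n).le)]
      exact mul_le_mul_of_nonneg_left hHi (one_div_nonneg.2 (hNpos' n).le)
    rw [hasDerivAt_iff_isLittleO, Asymptotics.isLittleO_iff]
    intro ε hε
    obtain ⟨δ, hδ, hev⟩ := hlocal ε hε
    filter_upwards [Metric.ball_mem_nhds t (half_pos hδ)] with x hx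
    rw [Metric.mem_ball, Real.dist_eq] at hx
    have hlim1 : Tendsto (fun n => |v n ⌊x * N n⌋ j - v n ⌊t * N n⌋ j -
        ((⌊x * N n⌋ : ℝ) / N n - ⌊t * N n⌋ / N n) * F|) (hyperfilter ℕ)
        (𝓝 |u x j - u t j - (x - t) * F|) :=
      (((hu x j).sub (hu t j)).sub (((hfloor x).sub (hfloor t)).mul_const F)).abs
    have hlim2 : Tendsto (fun n => ε * |(⌊x * N n⌋ : ℝ) / N n - ⌊t * N n⌋ / N n|)
        (hyperfilter ℕ) (𝓝 (ε * |x - t|)) :=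
      (((hfloor x).sub (hfloor t)).abs).const_mul ε
    rw [Real.norm_eq_abs, Real.norm_eq_abs, smul_eq_mul]
    refine le_of_tendsto_of_tendsto hlim1 hlim2 ?_
    filter_upwards [hev, hsmall (δ / 2) (half_pos hδ)] with n hn hn2
    have hx' := (abs_floor_mul_div_sub_le x (hNpos n)).trans ((hN_le n).trans hn2.le)
    have ht' := (abs_floor_mul_div_sub_le t (hNpos n)).trans ((hN_le n).trans hn2.le)
    have h1 := abs_sub_sub_mul_le_of_increments (w := fun i => v n i j) (A := 1 / N n * F)
      (e := 1 / N n * ε) (a := ⌊t * N n⌋) (b := ⌊x * N n⌋) (by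
        intro i hi1 hi2
        refine hn i ?_
        have e1 : ((min ⌊t * N n⌋ ⌊x * N n⌋ : ℤ) : ℝ) / N n ≤ i / N n :=
          div_le_div_of_nonneg_right (by exact_mod_cast hi1) (hNpos' n).le
        have e2 : (i : ℝ) / N n ≤ ((max ⌊t * N n⌋ ⌊x * N n⌋ : ℤ) : ℝ) / N n :=
          div_le_div_of_nonneg_right (by exact_mod_cast hi2.le) (hNpos' n).le
        rw [abs_le] at hx' ht' ⊢
        rw [abs_lt] at hx
        rcases le_total ⌊t * N n⌋ ⌊x * N n⌋ with hle | hle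
        · rw [min_eq_left hle] at e1
          rw [max_eq_right hle] at e2
          constructor <;> linarith
        · rw [min_eq_right hle] at e1
          rw [max_eq_left hle] at e2
          constructor <;> linarith)
    have e1 : ((⌊x * N n⌋ : ℝ) / N n - ⌊t * N n⌋ / N n) * F =
        ((⌊x * N n⌋ - ⌊t * N n⌋ : ℤ) : ℝ) * (1 / N n * F) := by push_cast; ring
    have e2 : |(⌊x * N n⌋ : ℝ) / N n - ⌊t * N n⌋ / N n| =
        |((⌊x * N n⌋ - ⌊t * N n⌋ : ℤ) : ℝ)| * (1 / N n) := by
      rw [← sub_div, abs_div, abs_of_pos (hNpos' n)]; push_cast; rw [div_eq_mul_one_div]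
    rw [e1, e2]
    exact h1.trans_eq (by ring)
  · refine le_of_tendsto' ((((hu t m).sub (hu t n)).sub_const _).abs) fun k => hbw k _ m n
  · have hshift : ∀ (t : ℝ) k, ⌊(t + s) * N k⌋ = ⌊t * N k⌋ + s * N k := by
      intro t k
      rw [add_mul, ← Int.floor_add_intCast]
      push_cast
      rfl
    have hS : ∀ (t : ℝ) j, Tendsto (fun k => v k (⌊t * N k⌋ + s * N k) (j - m) + (n : ℝ))
        (hyperfilter ℕ) (𝓝 (Smn m n (u (t + s)) j)) := by
      intro t j
      simpa only [hshift, Smn] using (hu (t + s) (j - m)).add_const (n : ℝ)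
    rcases Ultrafilter.eventually_or.1
      (Eventually.of_forall (f := (hyperfilter ℕ : Filter ℕ)) fun k => hord k m n s) with h | h
    · exact .inl fun t j => le_of_tendsto_of_tendsto (hu t j) (hS t j) (h.mono fun k hk => hk _ _)
    · exact .inr fun t j => le_of_tendsto_of_tendsto (hS t j) (hu t j) (h.mono fun k hk => hk _ _)

/-- Space-time translates of solutions are solutions. -/
theorem IsSolution.smn {M : FKModel} {u : ℝ → Conf} (hu : IsSolution M u) (m n s : ℤ) :
    IsSolution M fun t => Smn m n (u (t + s)) := by
  intro t j
  have h := ((hu (t + s) (j - m)).comp_add_const t (s : ℝ)).add_const (n : ℝ)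
  have hV : deriv M.V (u (t + s) (j - m) + n) = deriv M.V (u (t + s) (j - m)) := by
    simpa using M.periodic_deriv_V.int_mul n (u (t + s) (j - m))
  have hf : M.f (t + s) = M.f t := by simpa using M.periodic_f.int_mul s t
  have e : M.rhs t (Smn m n (u (t + s))) j = M.rhs (t + s) (u (t + s)) (j - m) := by
    simp only [FKModel.rhs, Smn, hV, hf, add_sub_add_right_eq_sub,
      show j + 1 - m = j - m + 1 by ring, show j - 1 - m = j - m - 1 by ring]
  rw [e]
  exact h

/-- Ordered entire solutions that touch at some site coincide at that time. -/
theorem IsSolution.eq_of_le_of_eq {M : FKModel} {u v : ℝ → Conf} (hu : IsSolution M u)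
    (hv : IsSolution M v) (hle : ∀ t j, u t j ≤ v t j) {t : ℝ} {j : ℤ} (h : u t j = v t j) :
    u t = v t := by
  have hnb : ∀ k, u t k = v t k → u t (k + 1) = v t (k + 1) ∧ u t (k - 1) = v t (k - 1) := by
    intro k hk
    have hmin : IsLocalMin (fun s => v s k - u s k) t := Eventually.of_forall fun s => by
      simp only [hk, sub_self]
      exact sub_nonneg.2 (hle s k)
    have h0 := hmin.hasDerivAt_eq_zero ((hv t k).sub (hu t k))
    simp only [FKModel.rhs, hk] at h0
    have hp := hle t (k + 1)
    have hq := hle t (k - 1)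
    have hW := M.strictMono_deriv_W
    have h1 : deriv M.W (u t (k + 1) - v t k) ≤ deriv M.W (v t (k + 1) - v t k) :=
      hW.monotone (by linarith)
    have h2 : deriv M.W (v t k - v t (k - 1)) ≤ deriv M.W (v t k - u t (k - 1)) :=
      hW.monotone (by linarith)
    have h3 := hW.injective (show deriv M.W (u t (k + 1) - v t k) =
      deriv M.W (v t (k + 1) - v t k) by linarith)
    have h4 := hW.injective (show deriv M.W (v t k - v t (k - 1)) =
      deriv M.W (v t k - u t (k - 1)) by linarith)
    constructor <;> linarith
  funext k
  induction k using Int.inductionOn' (b := j) with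
  | zero => exact h
  | succ k _ ih => exact (hnb k ih).1
  | pred k _ ih => exact (hnb k ih).2

/-- Under assumption (A), for every driving force and every mean
spacing `ρ`, there exists a globally defined synchronized solution of the FK
gradient dynamics all of whose configurations have bounded width with mean
spacing `ρ`. -/
theorem statement0 (M : FKModel) (ρ : ℝ) :
    ∃ u : ℝ → Conf, IsSolution M u ∧ (∀ t : ℝ, BW ρ (u t)) ∧
      ∀ (m n s : ℤ) (t : ℝ), ¬ Intersects (u t) (Smn m n (u (t + (s : ℝ)))) := by
  obtain ⟨u, hu, hbw, hord⟩ := exists_entire_ordered M ρ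
  refine ⟨u, hu, hbw, fun m n s t => ?_⟩
  rintro ⟨j, hne, hj⟩
  have hv := hu.smn m n s
  rcases hord m n s with h | h
  · have hpos : ∀ k, 0 < Smn m n (u (t + s)) k - u t k := fun k =>
      sub_pos.2 ((h t k).lt_of_ne fun e => hne (hu.eq_of_le_of_eq hv h e))
    exact hj.not_gt (mul_pos (hpos _) (hpos _))
  · have hneg : ∀ k, Smn m n (u (t + s)) k - u t k < 0 := fun k =>
      sub_neg.2 ((h t k).lt_of_ne fun e => hne (hv.eq_of_le_of_eq hu h e).symm)
    exact hj.not_gt (mul_pos_of_neg_of_neg (hneg _) (hneg _))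

end
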